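/- arXiv:1403.5223 — 2 statements merged into one kernel-verified Lean document; each statement's English description precedes it below -/
import Mathlib

section
/- Let F_∞ be the free group on countably many generators a₁,a₂,…, with word length |·|, and view F_d (d ≥ 2) as the subgroup generated by a₁,…,a_d. Fix p ∈ [1,∞), α ∈ (0,1), and define φ_α: F_∞ → ℂ by φ_α(s) = α^{|s|}. Then: (i) for all s, t₁, t₂ ∈ F_∞, α^{|t₁|} α^{|t₂|} φ_α(s) ≤ φ_α(t₁ s t₂) ≤ α^{−|t₁|} α^{−|t₂|} φ_α(s); and (ii) φ_α belongs to D_p(F_d) = {f ∈ ℓ^∞(F_∞) : f restricted to every double coset sF_d t is p-summable} if and only if α < (2d−1)^{−1/p}. -/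
noncomputable section

/-- The double coset `sHt`. -/
def doubleCoset {Γ : Type} [Group Γ] (H : Subgroup Γ) (s t : Γ) : Set Γ :=
  {g | ∃ h ∈ H, g = s * h * t}

/-- The ideal `D_p(H)` of bounded functions that are `p`-summable on every double
coset of `H`. -/
def DpIdeal (Γ : Type) [Group Γ] (H : Subgroup Γ) (p : ℝ) : Set (Γ → ℂ) :=
  {f | Memℓp f ⊤ ∧
    ∀ s t : Γ, Memℓp (fun g : doubleCoset H s t => f g) (ENNReal.ofReal p)}

namespace FreeGroup

/-- The words `w` of length `n` such that `a :: w` is reduced. -/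
def reducedTails {ι : Type*} [Fintype ι] [DecidableEq ι] :
    ℕ → ι × Bool → Finset (List (ι × Bool))
  | 0, _ => {[]}
  | n + 1, a => (Finset.univ.erase (a.1, !a.2)).biUnion fun b =>
      (reducedTails n b).image (List.cons b)

theorem mem_reducedTails {ι : Type*} [Fintype ι] [DecidableEq ι] {n : ℕ} {a : ι × Bool}
    {w : List (ι × Bool)} :
    w ∈ reducedTails n a ↔ w.length = n ∧ IsReduced (a :: w) := by
  induction n generalizing a w with
  | zero =>
    simp only [reducedTails, Finset.mem_singleton, List.length_eq_zero_iff]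
    exact ⟨fun h => ⟨h, h ▸ .singleton⟩, And.left⟩
  | succ n ih =>
    have key : ∀ b : ι × Bool, b ≠ (a.1, !a.2) ↔ (a.1 = b.1 → a.2 = b.2) := by
      rintro ⟨i, x⟩
      obtain ⟨j, y⟩ := a
      cases x <;> cases y <;> simp [eq_comm]
    cases w with
    | nil => simp [reducedTails]
    | cons b w => simp [reducedTails, ih, key]; tauto

theorem disjoint_image_cons {β : Type*} [DecidableEq β] {a b : β} (hab : a ≠ b)
    (s t : Finset (List β)) : Disjoint (s.image (List.cons a)) (t.image (List.cons b)) := by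
  simp only [Finset.disjoint_left, Finset.mem_image]
  rintro _ ⟨u, -, rfl⟩ ⟨v, -, h⟩
  exact hab (List.cons.inj h).1.symm

theorem card_reducedTails {ι : Type*} [Fintype ι] [DecidableEq ι] (n : ℕ) (a : ι × Bool) :
    (reducedTails n a).card = (2 * Fintype.card ι - 1) ^ n := by
  induction n generalizing a with
  | zero => simp [reducedTails]
  | succ n ih =>
    rw [reducedTails, Finset.card_biUnion fun b _ c _ hbc => disjoint_image_cons hbc _ _]
    simp [Finset.card_image_of_injective _ List.cons_injective, ih, pow_succ', mul_comm]

/-- The sphere of radius `n + 1` in a free group of rank `k` has `2 * k * (2 * k - 1) ^ n`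
elements. -/
theorem card_norm_eq_succ (ι : Type*) [Fintype ι] [DecidableEq ι] (n : ℕ) :
    Nat.card {x : FreeGroup ι // norm x = n + 1} =
      2 * Fintype.card ι * (2 * Fintype.card ι - 1) ^ n := by
  let W : Finset (List (ι × Bool)) :=
    Finset.univ.biUnion fun a => (reducedTails n a).image (List.cons a)
  have hW : ∀ w, w ∈ W ↔ w.length = n + 1 ∧ IsReduced w := by
    rintro (_ | ⟨b, w⟩) <;> simp [W, mem_reducedTails]
  have e : {x : FreeGroup ι // norm x = n + 1} ≃ W :=
    { toFun := fun x => ⟨x.1.toWord, (hW _).2 ⟨x.2, isReduced_toWord⟩⟩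
      invFun := fun w => ⟨mk w.1, by
        rw [norm, toWord_mk, ((hW _).1 w.2).2.reduce_eq, ((hW _).1 w.2).1]⟩
      left_inv := fun x => Subtype.ext mk_toWord
      right_inv := fun w => Subtype.ext <| by
        simp [((hW _).1 w.2).2.reduce_eq] }
  rw [Nat.card_congr e, Nat.card_eq_fintype_card, Fintype.card_coe,
    Finset.card_biUnion fun b _ c _ hbc => disjoint_image_cons hbc _ _]
  simp [Finset.card_image_of_injective _ List.cons_injective, card_reducedTails, mul_comm]

theorem finite_norm_eq (ι : Type*) [Finite ι] [DecidableEq ι] (n : ℕ) :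
    Finite {x : FreeGroup ι // norm x = n} := by
  have : Finite {l : List (ι × Bool) | l.length = n} := List.finite_length_eq _ n
  exact Finite.of_injective
    (fun x => (⟨x.1.toWord, x.2⟩ : {l : List (ι × Bool) | l.length = n}))
    fun x y h => Subtype.ext (toWord_injective (congrArg Subtype.val h))

/-- The growth series of a nontrivial free group of finite rank `k` converges at `β` iff
`(2 * k - 1) * β < 1`. -/
theorem summable_pow_norm_iff (ι : Type*) [Fintype ι] [Nonempty ι] [DecidableEq ι] {β : ℝ}
    (hβ : 0 < β) :
    Summable (fun x : FreeGroup ι => β ^ norm x) ↔ (2 * Fintype.card ι - 1 : ℝ) * β < 1 := by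
  have hk : 1 ≤ Fintype.card ι := Fintype.card_pos
  have hk' : (1 : ℝ) ≤ Fintype.card ι := by exact_mod_cast hk
  have hcast : ((2 * Fintype.card ι - 1 : ℕ) : ℝ) = 2 * Fintype.card ι - 1 := by
    rw [Nat.cast_sub (by omega)]; simp
  rw [← (Equiv.sigmaFiberEquiv (norm : FreeGroup ι → ℕ)).summable_iff,
    summable_sigma_of_nonneg fun x => by simp only [Function.comp_apply]; positivity]
  have hfib : ∀ (n : ℕ) (y : {x : FreeGroup ι // norm x = n}),
      ((fun x : FreeGroup ι => β ^ norm x) ∘ Equiv.sigmaFiberEquiv norm) ⟨n, y⟩ = β ^ n := by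
    rintro n ⟨x, hx⟩
    simp [Equiv.sigmaFiberEquiv, hx]
  have hfin := finite_norm_eq ι
  simp only [hfib, tsum_const, nsmul_eq_mul, Summable.of_finite, implies_true, true_and]
  rw [← summable_nat_add_iff 1]
  have hterm : ∀ n : ℕ, (Nat.card {x : FreeGroup ι // norm x = n + 1} : ℝ) * β ^ (n + 1) =
      (2 * Fintype.card ι * β) * ((2 * Fintype.card ι - 1 : ℝ) * β) ^ n := by
    intro n
    rw [card_norm_eq_succ, Nat.cast_mul, Nat.cast_pow, hcast]
    push_cast
    rw [mul_pow]
    ring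
  simp only [hterm]
  rw [summable_mul_left_iff (by positivity), summable_geometric_iff_norm_lt_one,
    Real.norm_of_nonneg (mul_nonneg (by linarith) hβ.le)]

theorem norm_map_of_injective {ι κ : Type*} [DecidableEq ι] [DecidableEq κ] {f : ι → κ}
    (hf : Function.Injective f) (x : FreeGroup ι) : norm (map f x) = norm x := by
  have hred : IsReduced (x.toWord.map fun a => (f a.1, a.2)) := by
    rw [IsReduced, List.isChain_map]
    simp only [hf.eq_iff]
    exact isReduced_toWord
  conv_lhs => rw [← mk_toWord (x := x), map.mk, norm, toWord_mk, hred.reduce_eq, List.length_map]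
  rfl

theorem norm_le_norm_mul_mul {ι : Type*} [DecidableEq ι] (s t₁ t₂ : FreeGroup ι) :
    norm s ≤ norm t₁ + norm t₂ + norm (t₁ * s * t₂) := by
  have h := norm_mul_le (t₁⁻¹ * (t₁ * s * t₂)) t₂⁻¹
  have h' := norm_mul_le t₁⁻¹ (t₁ * s * t₂)
  rw [norm_inv_eq] at h h'
  rw [show t₁⁻¹ * (t₁ * s * t₂) * t₂⁻¹ = s by group] at h
  omega

theorem norm_mul_mul_le {ι : Type*} [DecidableEq ι] (s t₁ t₂ : FreeGroup ι) :
    norm (t₁ * s * t₂) ≤ norm t₁ + norm t₂ + norm s := by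
  have h := norm_mul_le (t₁ * s) t₂
  have h' := norm_mul_le t₁ s
  omega

end FreeGroup

theorem lt_rpow_neg_inv_iff {p a c : ℝ} (hp : 0 < p) (ha : 0 < a) (hc : 0 < c) :
    a < c ^ (-p⁻¹) ↔ c * a ^ p < 1 := by
  rw [← Real.rpow_lt_rpow_iff ha.le (Real.rpow_nonneg hc.le _) hp, ← Real.rpow_mul hc.le,
    neg_mul, inv_mul_cancel₀ hp.ne', Real.rpow_neg_one, lt_inv_comm₀ (by positivity) hc,
    ← one_div, lt_div_iff₀ (by positivity)]

/-- Let `F_∞` be the free group on countably many generators,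
`F_d` the subgroup generated by the first `d ≥ 2` generators, `p ∈ [1,∞)`,
`α ∈ (0,1)` and `φ_α(s) = α^{|s|}`. Then (i) `α^{|t₁|}α^{|t₂|}φ_α(s) ≤ φ_α(t₁st₂)
≤ α^{−|t₁|}α^{−|t₂|}φ_α(s)` for all `s,t₁,t₂`, and (ii) `φ_α ∈ D_p(F_d)` iff
`α < (2d−1)^{−1/p}`. -/
theorem stmt8 (d : ℕ) (hd : 2 ≤ d) (p : ℝ) (hp : 1 ≤ p)
    (α : ℝ) (hα : α ∈ Set.Ioo (0:ℝ) 1)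
    (Fd : Subgroup (FreeGroup ℕ))
    (hFd : Fd = Subgroup.closure (Set.range fun i : Fin d => FreeGroup.of (i : ℕ)))
    (φα : FreeGroup ℕ → ℝ) (hφα : ∀ s, φα s = α ^ FreeGroup.norm s) :
    (∀ s t₁ t₂ : FreeGroup ℕ,
      α ^ FreeGroup.norm t₁ * α ^ FreeGroup.norm t₂ * φα s ≤ φα (t₁ * s * t₂) ∧
      φα (t₁ * s * t₂) ≤ (α ^ FreeGroup.norm t₁)⁻¹ * (α ^ FreeGroup.norm t₂)⁻¹ * φα s) ∧
    ((fun s : FreeGroup ℕ => ((φα s : ℝ) : ℂ)) ∈ DpIdeal (FreeGroup ℕ) Fd p ↔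
      α < ((2 * d - 1 : ℝ)) ^ (-p⁻¹)) := by
  obtain ⟨hα0, hα1⟩ := hα
  obtain rfl : φα = fun s => α ^ FreeGroup.norm s := funext hφα
  have hp0 : 0 < p := by linarith
  have hupper : ∀ s t₁ t₂ : FreeGroup ℕ, α ^ FreeGroup.norm (t₁ * s * t₂) ≤
      (α ^ FreeGroup.norm t₁)⁻¹ * (α ^ FreeGroup.norm t₂)⁻¹ * α ^ FreeGroup.norm s := by
    intro s t₁ t₂
    rw [← mul_inv, ← pow_add, le_inv_mul_iff₀ (by positivity), ← pow_add]
    exact pow_le_pow_of_le_one hα0.le hα1.le (FreeGroup.norm_le_norm_mul_mul s t₁ t₂)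
  refine ⟨fun s t₁ t₂ => ⟨?_, hupper s t₁ t₂⟩, ?_⟩
  · rw [← pow_add, ← pow_add]
    exact pow_le_pow_of_le_one hα0.le hα1.le (FreeGroup.norm_mul_mul_le s t₁ t₂)
  have : Nonempty (Fin d) := ⟨⟨0, by omega⟩⟩
  have hd' : (2 : ℝ) ≤ d := by exact_mod_cast hd
  have hinj : Function.Injective (Fin.val : Fin d → ℕ) := Fin.val_injective
  have hrange : (FreeGroup.map (Fin.val : Fin d → ℕ)).range = Fd := by
    rw [FreeGroup.range_map, hFd, ← Set.range_comp]
    rfl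
  have hsum := FreeGroup.summable_pow_norm_iff (Fin d) (Real.rpow_pos_of_pos hα0 p)
  rw [Fintype.card_fin] at hsum
  rw [lt_rpow_neg_inv_iff hp0 hα0 (by linarith), ← hsum]
  have hpow : ∀ n : ℕ, (α ^ n) ^ p = (α ^ p) ^ n := fun n => by
    rw [← Real.rpow_natCast, ← Real.rpow_natCast, ← Real.rpow_mul hα0.le, ← Real.rpow_mul hα0.le,
      mul_comm]
  have hnorm : ∀ n : ℕ, ‖((α ^ n : ℝ) : ℂ)‖ = α ^ n := fun n => by
    rw [Complex.norm_real, Real.norm_of_nonneg (by positivity)]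
  have hmem : ∀ s t : FreeGroup ℕ,
      Memℓp (fun g : doubleCoset Fd s t => ((α ^ FreeGroup.norm (g : FreeGroup ℕ) : ℝ) : ℂ))
        (ENNReal.ofReal p) ↔
      Summable fun g : doubleCoset Fd s t => (α ^ FreeGroup.norm (g : FreeGroup ℕ)) ^ p := by
    intro s t
    rw [memℓp_gen_iff (by rwa [ENNReal.toReal_ofReal hp0.le]), ENNReal.toReal_ofReal hp0.le]
    simp only [hnorm]
  constructor
  · rintro ⟨-, h⟩
    have h1 := (hmem 1 1).1 (h 1 1)
    let e : FreeGroup (Fin d) → doubleCoset Fd 1 1 := fun x =>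
      ⟨FreeGroup.map Fin.val x, FreeGroup.map Fin.val x, hrange ▸ ⟨x, rfl⟩, by simp⟩
    have he : Function.Injective e := fun x y hxy =>
      FreeGroup.map_injective hinj (congrArg Subtype.val hxy)
    refine (h1.comp_injective he).congr fun x => ?_
    simp only [Function.comp_apply, e, FreeGroup.norm_map_of_injective hinj, hpow]
  · intro h
    refine ⟨memℓp_infty ⟨1, ?_⟩, fun s t => (hmem s t).2 ?_⟩
    · rintro _ ⟨x, rfl⟩
      simp only [hnorm]
      exact pow_le_one₀ hα0.le hα1.le
    · have hex : ∀ g : doubleCoset Fd s t, ∃ x : FreeGroup (Fin d),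
          (g : FreeGroup ℕ) = s * FreeGroup.map Fin.val x * t := by
        rintro ⟨_, k, hk, rfl⟩
        rw [← hrange] at hk
        obtain ⟨x, rfl⟩ := hk
        exact ⟨x, rfl⟩
      choose e he using hex
      have heinj : Function.Injective e := fun x y hxy => by
        apply Subtype.ext
        rw [he, he, hxy]
      set C := (α ^ FreeGroup.norm s)⁻¹ * (α ^ FreeGroup.norm t)⁻¹
      refine Summable.of_nonneg_of_le (fun g => by positivity) (fun g => ?_)
        ((h.comp_injective heinj).mul_left (C ^ p))
      have hg := hupper (FreeGroup.map Fin.val (e g)) s t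
      rw [← he, FreeGroup.norm_map_of_injective hinj] at hg
      rw [Function.comp_apply, ← hpow, ← Real.mul_rpow (by positivity) (by positivity)]
      exact Real.rpow_le_rpow (by positivity) hg hp0.le
end
end

section
/- Let n ≥ 2 and let S be a dense unital subring of ℝ. Then SL_n(S), the group of n×n matrices with entries in S and determinant 1, is a dense subgroup of SL_n(ℝ) (with the topology inherited from the space of n×n real matrices). -/
namespace Matrix.SpecialLinearGroup

variable {ι F : Type*} [Fintype ι] [DecidableEq ι] [Field F]

lemma transvection_mul_transvection_neg_inv_mul_transvection {i j : ι} (hij : i ≠ j) {a : F}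
    (ha : a ≠ 0) :
    ((transvection hij a * transvection hij.symm (-a⁻¹) * transvection hij a :
      SpecialLinearGroup ι F) : Matrix ι ι F) =
      1 - single i i 1 - single j j 1 + single i j a - single j i a⁻¹ := by
  simp only [coe_mul, transvection_coe, mul_add, add_mul, one_mul, mul_one, single_mul_single_same,
    ne_eq, hij.symm, not_false_eq_true, single_mul_single_of_ne, mul_neg, neg_mul,
    mul_inv_cancel₀ ha, inv_mul_cancel₀ ha]
  ext k l
  simp only [add_apply, sub_apply, one_apply, single_apply, zero_apply]
  grind

lemma diag2n_eq_prod_transvection {i j : ι} (hij : i ≠ j) {a : F} (ha : a ≠ 0) :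
    diag2n hij a ha =
      (transvection hij a * transvection hij.symm (-a⁻¹) * transvection hij a) *
      (transvection hij (-1) * transvection hij.symm (-(-1)⁻¹) * transvection hij (-1)) := by
  refine Subtype.ext ?_
  rw [coe_mul, transvection_mul_transvection_neg_inv_mul_transvection hij ha,
    transvection_mul_transvection_neg_inv_mul_transvection hij (neg_ne_zero.2 one_ne_zero),
    diag2n_coe]
  simp only [mul_add, add_mul, mul_sub, sub_mul, one_mul, mul_one, single_mul_single_same,
    ne_eq, hij, hij.symm, not_false_eq_true, single_mul_single_of_ne]
  ext k l
  simp only [diagonal_apply, add_apply, sub_apply, one_apply, single_apply, zero_apply]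
  grind

theorem transvection_induction [Nontrivial ι] (P : SpecialLinearGroup ι F → Prop)
    (M : SpecialLinearGroup ι F)
    (htransvec : ∀ (i j : ι) (hij : i ≠ j) (a : F), P (transvection hij a))
    (hmul : ∀ A B, P A → P B → P (A * B)) : P M := by
  refine diagonal_transvection_induction' P M (fun i j hij c hc ↦ ?_) htransvec hmul
  rw [diag2n_eq_prod_transvection hij hc]
  have hP {a b : F} :
      P (transvection hij a * transvection hij.symm b * transvection hij a) :=
    hmul _ _ (hmul _ _ (htransvec ..) (htransvec ..)) (htransvec ..)
  exact hmul _ _ hP hP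

end Matrix.SpecialLinearGroup

/-- Let `n ≥ 2` and let `S` be a dense unital subring of `ℝ`.
Then `SL_n(S)` is dense in `SL_n(ℝ)`: every real `n×n` matrix of determinant `1`
lies in the closure of the set of determinant-one matrices with entries in `S`
(in the topology of the space of `n×n` real matrices). -/
theorem stmt14 (n : ℕ) (hn : 2 ≤ n) (S : Subring ℝ) (hS : Dense (S : Set ℝ)) :
    {A : Matrix (Fin n) (Fin n) ℝ | A.det = 1} ⊆
      closure {A : Matrix (Fin n) (Fin n) ℝ | A.det = 1 ∧ ∀ i j, A i j ∈ S} := by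
  have : Nontrivial (Fin n) := Fin.nontrivial_iff_two_le.2 hn
  intro A hA
  refine Matrix.SpecialLinearGroup.transvection_induction
    (fun M ↦ (M : Matrix (Fin n) (Fin n) ℝ) ∈ closure _) ⟨A, hA⟩ (fun i j hij a ↦ ?_)
    (fun M N hM hN ↦ ?_)
  · have hcont : Continuous fun c : ℝ ↦ Matrix.transvection i j c :=
      continuous_matrix fun k l ↦ by
        simp only [Matrix.transvection, Matrix.add_apply, Matrix.single_apply]
        split_ifs <;> fun_prop
    change Matrix.transvection i j a ∈ _
    refine map_mem_closure hcont (hS a) fun c hc ↦ ⟨Matrix.det_transvection_of_ne i j hij c, ?_⟩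
    exact S.matrix.add_mem S.matrix.one_mem fun k l ↦ by
      rw [Matrix.single_apply]
      split_ifs
      exacts [hc, S.zero_mem]
  · rw [Matrix.SpecialLinearGroup.coe_mul]
    exact map_mem_closure₂ continuous_mul hM hN fun X hX Y hY ↦
      ⟨by rw [Matrix.det_mul, hX.1, hY.1, mul_one], S.matrix.mul_mem hX.2 hY.2⟩
end
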